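/- arXiv:1807.06135 — 5 statements merged into one kernel-verified Lean document; each statement's English description precedes it below -/
import Mathlib

section
/- Theorem 1 (multivariate stochastic linearization). Let u be a random vector in ℝⁿ with nondegenerate Gaussian distribution of mean μ and positive-definite covariance Σ, and set u₀ = u − μ. Let f : ℝⁿ → ℝ be continuously differentiable such that f(u), f(u)², ∇f(u) and f(u)·u₀ are all integrable. Then the functional ε(N, M) = E[(f(u) − ⟨N, u₀⟩ − M)²] over N ∈ ℝⁿ, M ∈ ℝ is minimized at N = E[∇f(u)] and M = E[f(u)]; that is, E[(f(u) − ⟨E[∇f(u)], u₀⟩ − E[f(u)])²] ≤ E[(f(u) − ⟨N, u₀⟩ − M)²] for all N ∈ ℝⁿ and M ∈ ℝ. -/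
open MeasureTheory

/-- The nondegenerate multivariate Gaussian density on `ℝⁿ` with mean `μ` and
positive-definite covariance matrix `Cov`. -/
noncomputable def gaussianDensity {n : ℕ} (μ : Fin n → ℝ) (Cov : Matrix (Fin n) (Fin n) ℝ)
    (x : Fin n → ℝ) : ℝ :=
  (1 / Real.sqrt ((2 * Real.pi) ^ n * Cov.det)) *
    Real.exp (-(1 / 2) * ∑ i, (x i - μ i) * (Cov⁻¹.mulVec (fun j => x j - μ j)) i)

open Matrix in
theorem gaussianDensity_eq_exp_dotProduct {n : ℕ} (μ : Fin n → ℝ) (Cov : Matrix (Fin n) (Fin n) ℝ)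
    (x : Fin n → ℝ) :
    gaussianDensity μ Cov x = (1 / Real.sqrt ((2 * Real.pi) ^ n * Cov.det)) *
      Real.exp (-(1 / 2) * ((x - μ) ⬝ᵥ (Cov⁻¹ *ᵥ (x - μ)))) := rfl

theorem gaussianDensity_nonneg {n : ℕ} (μ : Fin n → ℝ) (Cov : Matrix (Fin n) (Fin n) ℝ)
    (x : Fin n → ℝ) : 0 ≤ gaussianDensity μ Cov x := by
  unfold gaussianDensity
  positivity

theorem differentiable_gaussianDensity {n : ℕ} (μ : Fin n → ℝ)
    (Cov : Matrix (Fin n) (Fin n) ℝ) : Differentiable ℝ (gaussianDensity μ Cov) := by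
  unfold gaussianDensity
  simp only [Matrix.mulVec, dotProduct]
  fun_prop

open Matrix in
theorem fderiv_gaussianDensity_single {n : ℕ} (μ : Fin n → ℝ) {Cov : Matrix (Fin n) (Fin n) ℝ}
    (hsymm : (Cov⁻¹)ᵀ = Cov⁻¹) (x : Fin n → ℝ) (i : Fin n) :
    fderiv ℝ (gaussianDensity μ Cov) x (Pi.single i 1) =
      -((∑ j, Cov⁻¹ i j * (x j - μ j)) * gaussianDensity μ Cov x) := by
  rw [← (differentiable_gaussianDensity μ Cov x).lineDeriv_eq_fderiv]
  apply HasLineDerivAt.lineDeriv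
  have hquad (t : ℝ) : (x + t • Pi.single i 1 - μ) ⬝ᵥ (Cov⁻¹ *ᵥ (x + t • Pi.single i 1 - μ)) =
      (x - μ) ⬝ᵥ (Cov⁻¹ *ᵥ (x - μ)) + 2 * t * (Cov⁻¹ *ᵥ (x - μ)) i + t ^ 2 * Cov⁻¹ i i := by
    have hcross : (x - μ) ⬝ᵥ (Cov⁻¹ *ᵥ Pi.single i 1) = (Cov⁻¹ *ᵥ (x - μ)) i := by
      rw [dotProduct_mulVec, ← mulVec_transpose, hsymm, dotProduct_single_one]
    rw [show x + t • Pi.single i 1 - μ = (x - μ) + t • Pi.single i 1 by abel]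
    simp only [mulVec_add, mulVec_smul, add_dotProduct, dotProduct_add, smul_dotProduct,
      dotProduct_smul, hcross, single_one_dotProduct, smul_eq_mul]
    simp only [mulVec_single_one, col_apply]
    ring
  have hd : HasDerivAt (fun t : ℝ => (1 / Real.sqrt ((2 * Real.pi) ^ n * Cov.det)) *
      Real.exp (-(1 / 2) * ((x - μ) ⬝ᵥ (Cov⁻¹ *ᵥ (x - μ)) + 2 * t * (Cov⁻¹ *ᵥ (x - μ)) i
        + t ^ 2 * Cov⁻¹ i i)))
      (-((Cov⁻¹ *ᵥ (x - μ)) i * gaussianDensity μ Cov x)) 0 := by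
    have h1 : HasDerivAt (fun t : ℝ => (-(1 / 2) * ((x - μ) ⬝ᵥ (Cov⁻¹ *ᵥ (x - μ))
        + 2 * t * (Cov⁻¹ *ᵥ (x - μ)) i + t ^ 2 * Cov⁻¹ i i))) (-(Cov⁻¹ *ᵥ (x - μ)) i) 0 := by
      have := ((((hasDerivAt_id (0 : ℝ)).const_mul 2).mul_const ((Cov⁻¹ *ᵥ (x - μ)) i)).const_add
        ((x - μ) ⬝ᵥ (Cov⁻¹ *ᵥ (x - μ)))).add
        (((hasDerivAt_id (0 : ℝ)).pow 2).mul_const (Cov⁻¹ i i)) |>.const_mul (-(1 / 2))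
      exact this.congr_deriv (by simp)
    refine (h1.exp.const_mul (1 / Real.sqrt ((2 * Real.pi) ^ n * Cov.det))).congr_deriv ?_
    rw [gaussianDensity_eq_exp_dotProduct]
    simp only [mul_zero, zero_mul, add_zero, ne_eq, OfNat.ofNat_ne_zero, not_false_eq_true, zero_pow]
    ring
  unfold HasLineDerivAt
  simp only [gaussianDensity_eq_exp_dotProduct, hquad] at hd ⊢
  exact hd

open Matrix in
theorem Matrix.PosDef.sq_le_mul_inv_quadratic {n : ℕ} {Cov : Matrix (Fin n) (Fin n) ℝ}
    (hpos : Cov.PosDef) (v : Fin n → ℝ) (j : Fin n) :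
    v j ^ 2 ≤ Cov j j * (v ⬝ᵥ (Cov⁻¹ *ᵥ v)) := by
  have hdet : IsUnit Cov.det := (isUnit_iff_isUnit_det _).1 hpos.isUnit
  have hjj : 0 < Cov j j := hpos.diag_pos
  have hsymm : (Cov⁻¹)ᵀ = Cov⁻¹ := by simpa using hpos.inv.isHermitian.eq
  set w : Fin n → ℝ := Cov *ᵥ Pi.single j 1 with hw
  have hAw : Cov⁻¹ *ᵥ w = Pi.single j 1 := by
    rw [hw, mulVec_mulVec, nonsing_inv_mul _ hdet, one_mulVec]
  have hwj : w j = Cov j j := by simp [hw]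
  have hwv : w ⬝ᵥ (Cov⁻¹ *ᵥ v) = v j := by
    rw [dotProduct_mulVec, ← mulVec_transpose, hsymm, hAw, single_one_dotProduct]
  have h := hpos.inv.posSemidef.dotProduct_mulVec_nonneg (Cov j j • v - v j • w)
  simp only [star_trivial, mulVec_sub, mulVec_smul, hAw, sub_dotProduct, dotProduct_sub,
    smul_dotProduct, dotProduct_smul, dotProduct_single_one, hwv, hwj, smul_eq_mul,
    Pi.sub_apply, Pi.smul_apply] at h
  have h' : 0 ≤ Cov j j * (Cov j j * (v ⬝ᵥ (Cov⁻¹ *ᵥ v)) - v j ^ 2) := by linarith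
  exact sub_nonneg.1 (nonneg_of_mul_nonneg_right h' hjj)

open Matrix in
theorem integrable_sq_mul_gaussianDensity {n : ℕ} (μ : Fin n → ℝ)
    {Cov : Matrix (Fin n) (Fin n) ℝ} (hpos : Cov.PosDef)
    (hint : Integrable (gaussianDensity μ Cov)) (j : Fin n) :
    Integrable (fun x => (x j - μ j) ^ 2 * gaussianDensity μ Cov x) := by
  have hdom : Integrable (fun x : Fin n → ℝ =>
      (4 * Cov j j) * gaussianDensity μ Cov ((Real.sqrt 2)⁻¹ • (x - μ) + μ)) :=
    (((hint.comp_add_right μ).comp_smul (inv_ne_zero (by positivity))).comp_sub_right μ).const_mul _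
  refine hdom.mono' ?_ (Filter.Eventually.of_forall fun x => ?_)
  · have := (differentiable_gaussianDensity μ Cov).continuous
    exact Continuous.aestronglyMeasurable (by fun_prop)
  rw [Real.norm_of_nonneg (mul_nonneg (sq_nonneg _) (gaussianDensity_nonneg _ _ _)),
    gaussianDensity_eq_exp_dotProduct, gaussianDensity_eq_exp_dotProduct]
  have hle := hpos.sq_le_mul_inv_quadratic (x - μ) j
  have hs : (Real.sqrt 2)⁻¹ * (Real.sqrt 2)⁻¹ = 1 / 2 := by
    rw [← mul_inv, Real.mul_self_sqrt (by norm_num)]; norm_num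
  simp only [add_sub_cancel_right, mulVec_smul, smul_dotProduct, dotProduct_smul, smul_eq_mul]
  rw [← mul_assoc (Real.sqrt 2)⁻¹, hs]
  set q := (x - μ) ⬝ᵥ (Cov⁻¹ *ᵥ (x - μ))
  have hC : 0 ≤ 1 / Real.sqrt ((2 * Real.pi) ^ n * Cov.det) := by positivity
  have hq : q ≤ 4 * Real.exp (q / 4) := by linarith [Real.add_one_le_exp (q / 4)]
  have hsplit : Real.exp (-(1 / 2) * (1 / 2 * q)) = Real.exp (q / 4) * Real.exp (-(1 / 2) * q) := by
    rw [← Real.exp_add]; ring_nf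
  rw [hsplit]
  have hjj : 0 < Cov j j := hpos.diag_pos
  calc (x j - μ j) ^ 2 * (1 / Real.sqrt ((2 * Real.pi) ^ n * Cov.det) * Real.exp (-(1 / 2) * q))
      ≤ (Cov j j * (4 * Real.exp (q / 4))) *
        (1 / Real.sqrt ((2 * Real.pi) ^ n * Cov.det) * Real.exp (-(1 / 2) * q)) := by
        refine mul_le_mul_of_nonneg_right (hle.trans ?_) (by positivity)
        exact mul_le_mul_of_nonneg_left hq hjj.le
    _ = _ := by ring

section GaussianVector

variable {Ω : Type*} [MeasureSpace Ω] {n : ℕ} {u : Ω → Fin n → ℝ} {μ : Fin n → ℝ}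
  {Cov : Matrix (Fin n) (Fin n) ℝ}

theorem integrable_comp_iff_integrable_mul_gaussianDensity (hu : Measurable u)
    (hlaw : Measure.map u (volume : Measure Ω) =
      (volume : Measure (Fin n → ℝ)).withDensity
        (fun x => ENNReal.ofReal (gaussianDensity μ Cov x)))
    {g : (Fin n → ℝ) → ℝ} (hg : Continuous g) :
    Integrable (fun ω => g (u ω)) ↔ Integrable (fun x => g x * gaussianDensity μ Cov x) := by
  have hm := (differentiable_gaussianDensity μ Cov).continuous.measurable.ennreal_ofReal
  rw [← Function.comp_def g u,
    ← integrable_map_measure hg.aestronglyMeasurable hu.aemeasurable, hlaw,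
    integrable_withDensity_iff hm (by simp)]
  simp only [ENNReal.toReal_ofReal (gaussianDensity_nonneg μ Cov _)]

theorem integral_comp_eq_integral_mul_gaussianDensity (hu : Measurable u)
    (hlaw : Measure.map u (volume : Measure Ω) =
      (volume : Measure (Fin n → ℝ)).withDensity
        (fun x => ENNReal.ofReal (gaussianDensity μ Cov x)))
    {g : (Fin n → ℝ) → ℝ} (hg : Continuous g) :
    ∫ ω, g (u ω) = ∫ x, g x * gaussianDensity μ Cov x := by
  have hm := (differentiable_gaussianDensity μ Cov).continuous.measurable.ennreal_ofReal
  rw [← integral_map hu.aemeasurable hg.aestronglyMeasurable, hlaw,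
    integral_withDensity_eq_integral_toReal_smul hm (by simp)]
  simp only [ENNReal.toReal_ofReal (gaussianDensity_nonneg μ Cov _), smul_eq_mul, mul_comm]

theorem memLp_two_gaussian_coord [IsProbabilityMeasure (volume : Measure Ω)]
    (hu : Measurable u) (hpos : Cov.PosDef)
    (hlaw : Measure.map u (volume : Measure Ω) =
      (volume : Measure (Fin n → ℝ)).withDensity
        (fun x => ENNReal.ofReal (gaussianDensity μ Cov x))) (j : Fin n) :
    MemLp (fun ω => u ω j - μ j) 2 := by
  have hint : Integrable (gaussianDensity μ Cov) := by
    simpa using (integrable_comp_iff_integrable_mul_gaussianDensity hu hlaw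
      (g := fun _ => 1) continuous_const).1 (integrable_const 1)
  refine (memLp_two_iff_integrable_sq (by fun_prop)).2 ?_
  exact (integrable_comp_iff_integrable_mul_gaussianDensity hu hlaw
    (g := fun x => (x j - μ j) ^ 2) (by fun_prop)).2
    (integrable_sq_mul_gaussianDensity μ hpos hint j)

/-- Multivariate Stein identity (Gaussian integration by parts). -/
theorem integral_mul_gaussian_coord_eq_sum (hu : Measurable u) (hpos : Cov.PosDef)
    (hlaw : Measure.map u (volume : Measure Ω) =
      (volume : Measure (Fin n → ℝ)).withDensity
        (fun x => ENNReal.ofReal (gaussianDensity μ Cov x)))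
    {g : (Fin n → ℝ) → ℝ} (hg : ContDiff ℝ 1 g)
    (hg₁ : Integrable (fun ω => g (u ω)))
    (hgrad : ∀ i, Integrable (fun ω => fderiv ℝ g (u ω) (Pi.single i 1)))
    (hgu : ∀ i, Integrable (fun ω => g (u ω) * (u ω i - μ i))) (k : Fin n) :
    ∫ ω, g (u ω) * (u ω k - μ k) =
      ∑ i, Cov k i * ∫ ω, fderiv ℝ g (u ω) (Pi.single i 1) := by
  have hdet : IsUnit Cov.det := (Matrix.isUnit_iff_isUnit_det _).1 hpos.isUnit
  have hsymm : (Cov⁻¹).transpose = Cov⁻¹ := by simpa using hpos.inv.isHermitian.eq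
  have hgc : Continuous g := hg.continuous
  have hgrad_cont (i : Fin n) : Continuous fun x => fderiv ℝ g x (Pi.single i 1) :=
    (hg.continuous_fderiv one_ne_zero).clm_apply continuous_const
  have hcoord (j : Fin n) : Continuous fun x : Fin n → ℝ => g x * (x j - μ j) := by fun_prop
  have hgu' (j : Fin n) :=
    (integrable_comp_iff_integrable_mul_gaussianDensity hu hlaw (hcoord j)).1 (hgu j)
  have hterm (i : Fin n) (x : Fin n → ℝ) :
      g x * fderiv ℝ (gaussianDensity μ Cov) x (Pi.single i 1) =
        -∑ j, Cov⁻¹ i j * (g x * (x j - μ j) * gaussianDensity μ Cov x) := by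
    rw [fderiv_gaussianDensity_single μ hsymm, mul_neg, Finset.sum_mul, Finset.mul_sum]
    congr 1
    exact Finset.sum_congr rfl fun j _ => by ring
  have hparts (i : Fin n) : ∫ ω, fderiv ℝ g (u ω) (Pi.single i 1) =
      ∑ j, Cov⁻¹ i j * ∫ ω, g (u ω) * (u ω j - μ j) := by
    have hρ' : Integrable
        (fun x => g x * fderiv ℝ (gaussianDensity μ Cov) x (Pi.single i 1)) := by
      simp only [hterm]
      exact (integrable_finsetSum _ fun j _ => (hgu' j).const_mul (Cov⁻¹ i j)).neg
    have h := integral_mul_fderiv_eq_neg_fderiv_mul_of_integrable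
      ((integrable_comp_iff_integrable_mul_gaussianDensity hu hlaw (hgrad_cont i)).1 (hgrad i))
      hρ'
      ((integrable_comp_iff_integrable_mul_gaussianDensity hu hlaw hgc).1 hg₁)
      (fun x _ => hg.differentiable one_ne_zero x)
      (fun x _ => differentiable_gaussianDensity μ Cov x)
    simp only [hterm] at h
    rw [integral_neg, neg_inj, integral_finsetSum _ fun j _ => (hgu' j).const_mul (Cov⁻¹ i j)] at h
    rw [integral_comp_eq_integral_mul_gaussianDensity hu hlaw (hgrad_cont i), ← h]
    refine Finset.sum_congr rfl fun j _ => ?_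
    rw [integral_const_mul, integral_comp_eq_integral_mul_gaussianDensity hu hlaw (hcoord j)]
  have hvec : (fun i => ∫ ω, fderiv ℝ g (u ω) (Pi.single i 1)) =
      Cov⁻¹.mulVec (fun j => ∫ ω, g (u ω) * (u ω j - μ j)) := funext hparts
  have hsolve := congrArg (fun w => Cov.mulVec w k) hvec
  simp only [Matrix.mulVec_mulVec, Matrix.mul_nonsing_inv _ hdet, Matrix.one_mulVec] at hsolve
  exact hsolve.symm

theorem integral_gaussian_coord [IsProbabilityMeasure (volume : Measure Ω)]
    (hu : Measurable u) (hpos : Cov.PosDef)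
    (hlaw : Measure.map u (volume : Measure Ω) =
      (volume : Measure (Fin n → ℝ)).withDensity
        (fun x => ENNReal.ofReal (gaussianDensity μ Cov x))) (k : Fin n) :
    ∫ ω, (u ω k - μ k) = 0 := by
  have h := integral_mul_gaussian_coord_eq_sum hu hpos hlaw (g := fun _ => 1) contDiff_const
    (integrable_const 1) (by simp)
    (fun i => by
      simpa using (memLp_two_gaussian_coord hu hpos hlaw i).integrable (by norm_num)) k
  simpa using h

theorem integral_gaussian_coord_mul [IsProbabilityMeasure (volume : Measure Ω)]
    (hu : Measurable u) (hpos : Cov.PosDef)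
    (hlaw : Measure.map u (volume : Measure Ω) =
      (volume : Measure (Fin n → ℝ)).withDensity
        (fun x => ENNReal.ofReal (gaussianDensity μ Cov x))) (j k : Fin n) :
    ∫ ω, (u ω j - μ j) * (u ω k - μ k) = Cov k j := by
  have hL := memLp_two_gaussian_coord hu hpos hlaw
  have hd (x : Fin n → ℝ) (i : Fin n) : fderiv ℝ (fun x : Fin n → ℝ => x j - μ j) x
      (Pi.single i 1) = (Pi.single i 1 : Fin n → ℝ) j := by
    rw [fderiv_sub_const, (hasFDerivAt_apply j x).fderiv]
    rfl
  have h := integral_mul_gaussian_coord_eq_sum hu hpos hlaw (g := fun x => x j - μ j)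
    (by fun_prop) ((hL j).integrable (by norm_num)) (fun i => by simp [hd])
    (fun i => (hL j).integrable_mul (hL i)) k
  simpa [hd, Pi.single_apply] using h

end GaussianVector

theorem integral_sq_le_integral_add_sq {Ω : Type*} [MeasurableSpace Ω] {P : Measure Ω}
    {e d : Ω → ℝ} (he : MemLp e 2 P) (hd : MemLp d 2 P) (horth : ∫ ω, e ω * d ω ∂P = 0) :
    ∫ ω, e ω ^ 2 ∂P ≤ ∫ ω, (e ω + d ω) ^ 2 ∂P := by
  have hed : Integrable (fun ω => 2 * (e ω * d ω)) P := (he.integrable_mul hd).const_mul 2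
  calc ∫ ω, e ω ^ 2 ∂P = ∫ ω, (e ω ^ 2 + 2 * (e ω * d ω)) ∂P := by
        rw [integral_add he.integrable_sq hed, integral_const_mul, horth]; ring
    _ ≤ _ := integral_mono (he.integrable_sq.add hed) (he.add hd).integrable_sq fun ω => by
        simp only [Pi.add_apply]
        nlinarith [sq_nonneg (d ω)]

/-- **Theorem 1 (multivariate stochastic linearization).** If `u` is a nondegenerate
Gaussian random vector in `ℝⁿ` with mean `μ` and positive-definite covariance `Cov`,
`u₀ = u − μ`, and `f : ℝⁿ → ℝ` is continuously differentiable with `f(u)`, `f(u)²`,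
`∇f(u)` and `f(u)·u₀` integrable, then the functional `ε(N,M) = E[(f(u) − ⟨N,u₀⟩ − M)²]`
is minimized at `N = E[∇f(u)]`, `M = E[f(u)]`. -/
theorem multivariate_stochastic_linearization
    {Ω : Type*} [MeasureSpace Ω] [IsProbabilityMeasure (volume : Measure Ω)]
    {n : ℕ} (u : Ω → Fin n → ℝ) (hu : Measurable u)
    (μ : Fin n → ℝ) (Cov : Matrix (Fin n) (Fin n) ℝ) (hpos : Cov.PosDef)
    (hlaw : Measure.map u (volume : Measure Ω) =
      (volume : Measure (Fin n → ℝ)).withDensity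
        (fun x => ENNReal.ofReal (gaussianDensity μ Cov x)))
    (f : (Fin n → ℝ) → ℝ) (hf : ContDiff ℝ 1 f)
    (hf₁ : Integrable (fun ω => f (u ω)))
    (hf₂ : Integrable (fun ω => (f (u ω)) ^ 2))
    (hgrad : ∀ i, Integrable (fun ω => fderiv ℝ f (u ω) (Pi.single i 1)))
    (hfu : ∀ i, Integrable (fun ω => f (u ω) * (u ω i - μ i))) :
    ∀ (N : Fin n → ℝ) (M : ℝ),
      (∫ ω, (f (u ω)
          - (∑ i, (∫ ω', fderiv ℝ f (u ω') (Pi.single i 1)) * (u ω i - μ i))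
          - (∫ ω', f (u ω'))) ^ 2)
        ≤ ∫ ω, (f (u ω) - (∑ i, N i * (u ω i - μ i)) - M) ^ 2 := by
  intro N M
  have hL := memLp_two_gaussian_coord hu hpos hlaw
  have hfL : MemLp (fun ω => f (u ω)) 2 := (memLp_two_iff_integrable_sq hf₁.1).2 hf₂
  have hlin (c : Fin n → ℝ) : MemLp (fun ω => ∑ i, c i * (u ω i - μ i)) 2 :=
    memLp_finsetSum _ fun i _ => (hL i).const_mul (c i)
  set a : Fin n → ℝ := fun i => ∫ ω', fderiv ℝ f (u ω') (Pi.single i 1)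
  set m : ℝ := ∫ ω', f (u ω')
  set e : Ω → ℝ := fun ω => f (u ω) - (∑ i, a i * (u ω i - μ i)) - m with he_def
  have he : MemLp e 2 := (hfL.sub (hlin a)).sub (memLp_const m)
  have hd : MemLp (fun ω => (∑ i, (a i - N i) * (u ω i - μ i)) + (m - M)) 2 :=
    (hlin fun i => a i - N i).add (memLp_const _)
  have hL₁ (i : Fin n) : Integrable fun ω => u ω i - μ i := (hL i).integrable (by norm_num)
  have hLL (i k : Fin n) : Integrable fun ω => a i * ((u ω i - μ i) * (u ω k - μ k)) :=
    ((hL i).integrable_mul (hL k)).const_mul _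
  have hlin₁ : Integrable fun ω => ∑ i, a i * (u ω i - μ i) := (hlin a).integrable (by norm_num)
  have hf_lin : Integrable fun ω => f (u ω) - ∑ i, a i * (u ω i - μ i) := hf₁.sub hlin₁
  have he_mean : ∫ ω, e ω = 0 := by
    rw [integral_sub hf_lin (integrable_const _), integral_sub hf₁ hlin₁,
      integral_finsetSum _ fun i _ => (hL₁ i).const_mul _]
    simp [integral_const_mul, integral_gaussian_coord hu hpos hlaw, m]
  have he_coord (k : Fin n) : ∫ ω, e ω * (u ω k - μ k) = 0 := by
    have hexp (ω : Ω) : e ω * (u ω k - μ k) = f (u ω) * (u ω k - μ k)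
        - (∑ i, a i * ((u ω i - μ i) * (u ω k - μ k))) - m * (u ω k - μ k) := by
      simp only [he_def, sub_mul, Finset.sum_mul, mul_assoc]
    have hsum : Integrable fun ω => ∑ i, a i * ((u ω i - μ i) * (u ω k - μ k)) :=
      integrable_finsetSum _ fun i _ => hLL i k
    have hdiff : Integrable fun ω => f (u ω) * (u ω k - μ k)
        - ∑ i, a i * ((u ω i - μ i) * (u ω k - μ k)) := (hfu k).sub hsum
    simp only [hexp]
    rw [integral_sub hdiff ((hL₁ k).const_mul m), integral_sub (hfu k) hsum,
      integral_finsetSum _ fun i _ => hLL i k,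
      integral_mul_gaussian_coord_eq_sum hu hpos hlaw hf hf₁ hgrad hfu k]
    simp only [integral_const_mul, integral_gaussian_coord hu hpos hlaw,
      integral_gaussian_coord_mul hu hpos hlaw]
    simp [a, mul_comm]
  have horth : ∫ ω, e ω * ((∑ i, (a i - N i) * (u ω i - μ i)) + (m - M)) = 0 := by
    have hexp (ω : Ω) : e ω * ((∑ i, (a i - N i) * (u ω i - μ i)) + (m - M)) =
        (∑ i, (a i - N i) * (e ω * (u ω i - μ i))) + (m - M) * e ω := by
      rw [mul_add, Finset.mul_sum, mul_comm (e ω) (m - M)]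
      congr 1
      exact Finset.sum_congr rfl fun i _ => by ring
    have hi (i : Fin n) : Integrable fun ω => (a i - N i) * (e ω * (u ω i - μ i)) :=
      (he.integrable_mul (hL i)).const_mul _
    simp only [hexp]
    rw [integral_add (integrable_finsetSum _ fun i _ => hi i)
        ((he.integrable (by norm_num)).const_mul _),
      integral_finsetSum _ fun i _ => hi i]
    simp [integral_const_mul, he_coord, he_mean]
  refine (integral_sq_le_integral_add_sq he hd horth).trans_eq ?_
  congr 1
  ext ω
  simp only [he_def, sub_mul, Finset.sum_sub_distrib]
  ring
end

section
/- Reduction of the first quasilinear gain to a single erf integral. For all μ₁, μ₂, α, β ∈ ℝ, σ₁, σ₂ > 0 and ρ ∈ (−1, 1), ∫_{max(α,−β)}^{∞} ∫_{α−u₂}^{β+u₂} 𝒩(u₁, u₂) du₁ du₂ = ∫_{t₀}^{∞} (√2·e^{−t²/2}/(4√π))·[erf(γ₁(t)) + erf(γ₂(t))] dt. -/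
open MeasureTheory

/-- The error function `erf x = (2/√π) ∫₀ˣ e^{−s²} ds`. -/
noncomputable def erf (x : ℝ) : ℝ :=
  (2 / Real.sqrt Real.pi) * ∫ s in (0 : ℝ)..x, Real.exp (-s ^ 2)

/-- The bivariate Gaussian density with means `μ₁, μ₂`, standard deviations `σ₁, σ₂`
and correlation `ρ`. -/
noncomputable def biGauss (μ₁ μ₂ σ₁ σ₂ ρ : ℝ) (u₁ u₂ : ℝ) : ℝ :=
  (1 / (2 * Real.pi * σ₁ * σ₂ * Real.sqrt (1 - ρ ^ 2))) *
    Real.exp (-(((u₁ - μ₁) / σ₁) ^ 2 + ((u₂ - μ₂) / σ₂) ^ 2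
        - 2 * ρ * ((u₁ - μ₁) / σ₁) * ((u₂ - μ₂) / σ₂)) / (2 * (1 - ρ ^ 2)))

/-- `γ₁(t) = √2 (μ₁ − α + μ₂ + (σ₂ + ρσ₁) t) / (2σ₁ √(1−ρ²))`. -/
noncomputable def gamma1 (μ₁ μ₂ σ₁ σ₂ ρ α : ℝ) (t : ℝ) : ℝ :=
  Real.sqrt 2 * (μ₁ - α + μ₂ + (σ₂ + ρ * σ₁) * t) / (2 * σ₁ * Real.sqrt (1 - ρ ^ 2))

/-- `γ₂(t) = √2 (β − μ₁ + μ₂ + (σ₂ − ρσ₁) t) / (2σ₁ √(1−ρ²))`. -/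
noncomputable def gamma2 (μ₁ μ₂ σ₁ σ₂ ρ β : ℝ) (t : ℝ) : ℝ :=
  Real.sqrt 2 * (β - μ₁ + μ₂ + (σ₂ - ρ * σ₁) * t) / (2 * σ₁ * Real.sqrt (1 - ρ ^ 2))

theorem erf_neg (x : ℝ) : erf (-x) = -erf x := by
  have h := intervalIntegral.integral_comp_neg (a := 0) (b := x) fun s : ℝ => Real.exp (-s ^ 2)
  simp only [neg_sq, neg_zero] at h
  rw [erf, erf, h, intervalIntegral.integral_symm, mul_neg]

theorem integral_exp_neg_sq_eq_erf_sub_erf (a b : ℝ) :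
    ∫ s in a..b, Real.exp (-s ^ 2) = Real.sqrt Real.pi / 2 * (erf b - erf a) := by
  have hint (a b : ℝ) : IntervalIntegrable (fun s : ℝ => Real.exp (-s ^ 2)) volume a b :=
    (by fun_prop : Continuous fun s : ℝ => Real.exp (-s ^ 2)).intervalIntegrable a b
  have hpi : Real.sqrt Real.pi ≠ 0 := (Real.sqrt_pos.2 Real.pi_pos).ne'
  rw [erf, erf, ← intervalIntegral.integral_interval_sub_left (hint 0 b) (hint 0 a)]
  field_simp

/-- The bivariate density splits into a centred Gaussian in the standardized second variable `t`
and a Gaussian in the standardized conditional first variable. -/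
theorem biGauss_eq_mul_exp (μ₁ μ₂ ρ u t : ℝ) {σ₁ σ₂ : ℝ} (hσ₁ : 0 < σ₁) (hσ₂ : 0 < σ₂)
    (hρ : ρ ∈ Set.Ioo (-1 : ℝ) 1) :
    biGauss μ₁ μ₂ σ₁ σ₂ ρ u (σ₂ * t + μ₂) =
      1 / (2 * Real.pi * σ₁ * σ₂ * Real.sqrt (1 - ρ ^ 2)) * Real.exp (-t ^ 2 / 2) *
        Real.exp (-((Real.sqrt 2 * σ₁ * Real.sqrt (1 - ρ ^ 2))⁻¹ * u -
          (Real.sqrt 2 * σ₁ * Real.sqrt (1 - ρ ^ 2))⁻¹ * (μ₁ + ρ * σ₁ * t)) ^ 2) := by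
  have hpos : 0 < 1 - ρ ^ 2 := by nlinarith [hρ.1, hρ.2]
  rw [biGauss, mul_assoc _ (Real.exp _), ← Real.exp_add, ← mul_sub, mul_pow, inv_pow, mul_pow,
    mul_pow, Real.sq_sqrt hpos.le, Real.sq_sqrt zero_le_two]
  congr 2
  field_simp
  ring

theorem integral_biGauss_eq_erf (μ₁ μ₂ ρ α β t : ℝ) {σ₁ σ₂ : ℝ} (hσ₁ : 0 < σ₁) (hσ₂ : 0 < σ₂)
    (hρ : ρ ∈ Set.Ioo (-1 : ℝ) 1) :
    σ₂ * ∫ u in (α - (σ₂ * t + μ₂))..(β + (σ₂ * t + μ₂)),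
        biGauss μ₁ μ₂ σ₁ σ₂ ρ u (σ₂ * t + μ₂) =
      Real.sqrt 2 * Real.exp (-t ^ 2 / 2) / (4 * Real.sqrt Real.pi) *
        (erf (gamma1 μ₁ μ₂ σ₁ σ₂ ρ α t) + erf (gamma2 μ₁ μ₂ σ₁ σ₂ ρ β t)) := by
  have hpos : 0 < Real.sqrt (1 - ρ ^ 2) := Real.sqrt_pos.2 (by nlinarith [hρ.1, hρ.2])
  have h2 : 0 < Real.sqrt 2 := Real.sqrt_pos.2 two_pos
  have h2sq : Real.sqrt 2 ^ 2 = 2 := Real.sq_sqrt zero_le_two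
  have hpi : 0 < Real.sqrt Real.pi := Real.sqrt_pos.2 Real.pi_pos
  have hpisq : Real.pi = Real.sqrt Real.pi ^ 2 := (Real.sq_sqrt Real.pi_pos.le).symm
  have hlow : (Real.sqrt 2 * σ₁ * Real.sqrt (1 - ρ ^ 2))⁻¹ * (α - (σ₂ * t + μ₂)) -
      (Real.sqrt 2 * σ₁ * Real.sqrt (1 - ρ ^ 2))⁻¹ * (μ₁ + ρ * σ₁ * t) =
        -gamma1 μ₁ μ₂ σ₁ σ₂ ρ α t := by
    rw [gamma1]
    field_simp
    rw [h2sq]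
    ring
  have hupp : (Real.sqrt 2 * σ₁ * Real.sqrt (1 - ρ ^ 2))⁻¹ * (β + (σ₂ * t + μ₂)) -
      (Real.sqrt 2 * σ₁ * Real.sqrt (1 - ρ ^ 2))⁻¹ * (μ₁ + ρ * σ₁ * t) =
        gamma2 μ₁ μ₂ σ₁ σ₂ ρ β t := by
    rw [gamma2]
    field_simp
    rw [h2sq]
    ring
  simp_rw [biGauss_eq_mul_exp μ₁ μ₂ ρ _ t hσ₁ hσ₂ hρ]
  rw [intervalIntegral.integral_const_mul,
    intervalIntegral.integral_comp_mul_sub (fun s => Real.exp (-s ^ 2)) (by positivity),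
    hlow, hupp, integral_exp_neg_sq_eq_erf_sub_erf, erf_neg, smul_eq_mul, inv_inv]
  nth_rewrite 1 [hpisq]
  field_simp
  ring

theorem integral_Ioi_comp_mul_add (f : ℝ → ℝ) (a d : ℝ) {c : ℝ} (hc : 0 < c) :
    ∫ u in Set.Ioi a, f u = ∫ t in Set.Ioi ((a - d) / c), c * f (c * t + d) := by
  rw [integral_const_mul,
    integral_comp_mul_left_Ioi (fun x => f (x + d)) _ hc, mul_div_cancel₀ _ hc.ne', smul_eq_mul,
    mul_inv_cancel_left₀ hc.ne',
    ← (measurePreserving_add_right volume d).setIntegral_preimage_emb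
      (measurableEmbedding_addRight d) f (Set.Ioi a)]
  simp

/-- **Reduction of the first quasilinear gain to a single erf integral.** -/
theorem first_gain_single_integral
    (μ₁ μ₂ σ₁ σ₂ ρ α β : ℝ) (hσ₁ : 0 < σ₁) (hσ₂ : 0 < σ₂)
    (hρ : ρ ∈ Set.Ioo (-1 : ℝ) 1) :
    (∫ u₂ in Set.Ioi (max α (-β)), ∫ u₁ in (α - u₂)..(β + u₂),
        biGauss μ₁ μ₂ σ₁ σ₂ ρ u₁ u₂) =
      ∫ t in Set.Ioi ((max α (-β) - μ₂) / σ₂),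
        Real.sqrt 2 * Real.exp (-t ^ 2 / 2) / (4 * Real.sqrt Real.pi) *
          (erf (gamma1 μ₁ μ₂ σ₁ σ₂ ρ α t) + erf (gamma2 μ₁ μ₂ σ₁ σ₂ ρ β t)) := by
  rw [integral_Ioi_comp_mul_add _ _ μ₂ hσ₂]
  simp_rw [integral_biGauss_eq_erf μ₁ μ₂ ρ α β _ hσ₁ hσ₂ hρ]
end

section
/- Reduction of the second quasilinear gain to a single erf integral. For all μ₁, μ₂, α, β ∈ ℝ, σ₁, σ₂ > 0 and ρ ∈ (−1, 1), ∫_{max(α,−β)}^{∞} ∫_{−∞}^{α−u₂} (−1)·𝒩(u₁, u₂) du₁ du₂ + ∫_{max(α,−β)}^{∞} ∫_{β+u₂}^{∞} 𝒩(u₁, u₂) du₁ du₂ = ∫_{t₀}^{∞} (√2·e^{−t²/2}/(4√π))·[erf(γ₁(t)) − erf(γ₂(t))] dt. -/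
open MeasureTheory

theorem integrable_exp_neg_sq : Integrable fun s : ℝ => Real.exp (-s ^ 2) := by
  simpa using integrable_exp_neg_mul_sq (b := 1) one_pos

theorem integral_Ioi_exp_neg_sq (a : ℝ) :
    ∫ s in Set.Ioi a, Real.exp (-s ^ 2) = Real.sqrt Real.pi / 2 * (1 - erf a) := by
  have h := intervalIntegral.integral_Ioi_sub_Ioi'
    (integrable_exp_neg_sq.integrableOn (s := Set.Ioi 0))
    (integrable_exp_neg_sq.integrableOn (s := Set.Ioi a))
  have h0 : ∫ s in Set.Ioi (0 : ℝ), Real.exp (-s ^ 2) = Real.sqrt Real.pi / 2 := by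
    simpa using integral_gaussian_Ioi 1
  have hpi : Real.sqrt Real.pi ≠ 0 := by positivity
  rw [erf, ← h, h0]
  field_simp
  ring

theorem continuous_erf : Continuous erf :=
  continuous_const.mul <| intervalIntegral.continuous_primitive
    (fun _ _ => integrable_exp_neg_sq.intervalIntegrable) 0

theorem abs_one_sub_erf_le (x : ℝ) : |1 - erf x| ≤ 2 := by
  have hpi : 0 < Real.sqrt Real.pi := by positivity
  have h := integral_Ioi_exp_neg_sq x
  have hnonneg : 0 ≤ ∫ s in Set.Ioi x, Real.exp (-s ^ 2) :=
    integral_nonneg fun s => (Real.exp_pos _).le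
  have hle : ∫ s in Set.Ioi x, Real.exp (-s ^ 2) ≤ Real.sqrt Real.pi := by
    refine (setIntegral_le_integral integrable_exp_neg_sq
      (ae_of_all _ fun s => (Real.exp_pos _).le)).trans_eq ?_
    simpa using integral_gaussian 1
  rw [h] at hnonneg hle
  rw [abs_le]
  constructor <;> nlinarith

theorem setIntegral_Ioi_eq_affine (g : ℝ → ℝ) (a m : ℝ) {c : ℝ} (hc : 0 < c) :
    ∫ u in Set.Ioi a, g u = c * ∫ t in Set.Ioi ((a - m) / c), g (m + c * t) := by
  rw [integral_comp_mul_left_Ioi (fun x => g (m + x)) _ hc, smul_eq_mul,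
    mul_inv_cancel_left₀ hc.ne', mul_div_cancel₀ _ hc.ne',
    ← integral_indicator measurableSet_Ioi, ← integral_indicator measurableSet_Ioi,
    ← integral_add_left_eq_self _ m]
  refine integral_congr_ae (ae_of_all _ fun x => ?_)
  simp only [Set.indicator, Set.mem_Ioi, sub_lt_iff_lt_add']

theorem integral_Ioi_exp_neg_sq_affine (a m : ℝ) {c : ℝ} (hc : 0 < c) :
    ∫ u in Set.Ioi a, Real.exp (-((u - m) / c) ^ 2) =
      c * (Real.sqrt Real.pi / 2 * (1 - erf ((a - m) / c))) := by
  rw [setIntegral_Ioi_eq_affine _ a m hc, ← integral_Ioi_exp_neg_sq]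
  congr! 6
  field_simp
  ring

theorem integral_Iio_exp_neg_sq_affine (a m : ℝ) {c : ℝ} (hc : 0 < c) :
    ∫ u in Set.Iio a, Real.exp (-((u - m) / c) ^ 2) =
      c * (Real.sqrt Real.pi / 2 * (1 - erf ((m - a) / c))) := by
  have h := integral_Ioi_exp_neg_sq_affine (-a) (-m) hc
  rw [← integral_Iic_eq_integral_Iio, ← neg_neg a, ← integral_comp_neg_Ioi, neg_neg,
    show m - a = -a - -m by ring, ← h]
  congr! 3 with u
  ring

theorem biGauss_eq_conditional (μ₁ μ₂ : ℝ) {σ₁ σ₂ ρ : ℝ} (hσ₁ : 0 < σ₁) (hσ₂ : 0 < σ₂)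
    (hρ : ρ ∈ Set.Ioo (-1 : ℝ) 1) (u t : ℝ) :
    biGauss μ₁ μ₂ σ₁ σ₂ ρ u (μ₂ + σ₂ * t) =
      1 / (2 * Real.pi * σ₁ * σ₂ * Real.sqrt (1 - ρ ^ 2)) * Real.exp (-t ^ 2 / 2) *
        Real.exp (-((u - (μ₁ + ρ * σ₁ * t)) / (Real.sqrt 2 * σ₁ * Real.sqrt (1 - ρ ^ 2))) ^ 2) := by
  have hr : 0 < 1 - ρ ^ 2 := by nlinarith [hρ.1, hρ.2]
  rw [biGauss, mul_assoc _ (Real.exp _) (Real.exp _), ← Real.exp_add]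
  congr 2
  rw [div_pow (u - (μ₁ + ρ * σ₁ * t)), mul_pow, mul_pow, Real.sq_sqrt hr.le,
    Real.sq_sqrt zero_le_two, add_sub_cancel_left, mul_div_cancel_left₀ _ hσ₂.ne']
  field_simp
  ring

/-- The Gaussian weight `exp (-t² / 2) / √(2π)` times the upper tail `(1 - erf) / 2`. -/
noncomputable def gaussTail (γ : ℝ → ℝ) (t : ℝ) : ℝ :=
  Real.sqrt 2 * Real.exp (-t ^ 2 / 2) / (4 * Real.sqrt Real.pi) * (1 - erf (γ t))

theorem integrable_gaussTail {γ : ℝ → ℝ} (hγ : Continuous γ) : Integrable (gaussTail γ) := by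
  have h : Integrable fun t : ℝ =>
      Real.sqrt 2 * Real.exp (-t ^ 2 / 2) / (4 * Real.sqrt Real.pi) := by
    have := integrable_exp_neg_mul_sq (b := 1 / 2) (by norm_num)
    refine ((this.const_mul (Real.sqrt 2)).div_const (4 * Real.sqrt Real.pi)).congr
      (ae_of_all _ fun t => ?_)
    ring_nf
  exact h.mul_bdd (c := 2) (continuous_const.sub (continuous_erf.comp hγ)).aestronglyMeasurable
    (ae_of_all _ fun t => abs_one_sub_erf_le _)

theorem gaussian_prefactor {σ₁ σ₂ r : ℝ} (hσ₁ : 0 < σ₁) (hσ₂ : 0 < σ₂) (hr : 0 < r)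
    (e w : ℝ) :
    σ₂ * (1 / (2 * Real.pi * σ₁ * σ₂ * r) * e *
      (Real.sqrt 2 * σ₁ * r * (Real.sqrt Real.pi / 2 * w))) =
      Real.sqrt 2 * e / (4 * Real.sqrt Real.pi) * w := by
  have hpi : 0 < Real.sqrt Real.pi := by positivity
  nth_rewrite 1 [← Real.sq_sqrt Real.pi_pos.le]
  field_simp
  ring

theorem integral_Ioi_biGauss (μ₁ μ₂ β a : ℝ) {σ₁ σ₂ ρ : ℝ} (hσ₁ : 0 < σ₁) (hσ₂ : 0 < σ₂)
    (hρ : ρ ∈ Set.Ioo (-1 : ℝ) 1) :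
    ∫ u₂ in Set.Ioi a, ∫ u₁ in Set.Ioi (β + u₂), biGauss μ₁ μ₂ σ₁ σ₂ ρ u₁ u₂ =
      ∫ t in Set.Ioi ((a - μ₂) / σ₂), gaussTail (gamma2 μ₁ μ₂ σ₁ σ₂ ρ β) t := by
  have hr : 0 < Real.sqrt (1 - ρ ^ 2) := Real.sqrt_pos.2 (by nlinarith [hρ.1, hρ.2])
  rw [setIntegral_Ioi_eq_affine _ a μ₂ hσ₂, ← integral_const_mul]
  congr! 2 with t
  simp_rw [biGauss_eq_conditional μ₁ μ₂ hσ₁ hσ₂ hρ]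
  rw [integral_const_mul, integral_Ioi_exp_neg_sq_affine _ _ (by positivity),
    gaussian_prefactor hσ₁ hσ₂ hr, gaussTail, gamma2]
  congr! 3
  have h2 : Real.sqrt 2 ^ 2 = 2 := Real.sq_sqrt zero_le_two
  field_simp
  rw [h2]
  ring

theorem integral_Iio_biGauss (μ₁ μ₂ α a : ℝ) {σ₁ σ₂ ρ : ℝ} (hσ₁ : 0 < σ₁) (hσ₂ : 0 < σ₂)
    (hρ : ρ ∈ Set.Ioo (-1 : ℝ) 1) :
    ∫ u₂ in Set.Ioi a, ∫ u₁ in Set.Iio (α - u₂), biGauss μ₁ μ₂ σ₁ σ₂ ρ u₁ u₂ =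
      ∫ t in Set.Ioi ((a - μ₂) / σ₂), gaussTail (gamma1 μ₁ μ₂ σ₁ σ₂ ρ α) t := by
  have hr : 0 < Real.sqrt (1 - ρ ^ 2) := Real.sqrt_pos.2 (by nlinarith [hρ.1, hρ.2])
  rw [setIntegral_Ioi_eq_affine _ a μ₂ hσ₂, ← integral_const_mul]
  congr! 2 with t
  simp_rw [biGauss_eq_conditional μ₁ μ₂ hσ₁ hσ₂ hρ]
  rw [integral_const_mul, integral_Iio_exp_neg_sq_affine _ _ (by positivity),
    gaussian_prefactor hσ₁ hσ₂ hr, gaussTail, gamma1]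
  congr! 3
  have h2 : Real.sqrt 2 ^ 2 = 2 := Real.sq_sqrt zero_le_two
  field_simp
  rw [h2]
  ring

/-- **Reduction of the second quasilinear gain to a single erf integral.** -/
theorem second_gain_single_integral
    (μ₁ μ₂ σ₁ σ₂ ρ α β : ℝ) (hσ₁ : 0 < σ₁) (hσ₂ : 0 < σ₂)
    (hρ : ρ ∈ Set.Ioo (-1 : ℝ) 1) :
    (∫ u₂ in Set.Ioi (max α (-β)), ∫ u₁ in Set.Iio (α - u₂),
        (-1 : ℝ) * biGauss μ₁ μ₂ σ₁ σ₂ ρ u₁ u₂) +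
      (∫ u₂ in Set.Ioi (max α (-β)), ∫ u₁ in Set.Ioi (β + u₂),
        biGauss μ₁ μ₂ σ₁ σ₂ ρ u₁ u₂) =
      ∫ t in Set.Ioi ((max α (-β) - μ₂) / σ₂),
        Real.sqrt 2 * Real.exp (-t ^ 2 / 2) / (4 * Real.sqrt Real.pi) *
          (erf (gamma1 μ₁ μ₂ σ₁ σ₂ ρ α t) - erf (gamma2 μ₁ μ₂ σ₁ σ₂ ρ β t)) := by
  have h1 : Continuous (gamma1 μ₁ μ₂ σ₁ σ₂ ρ α) := by unfold gamma1; fun_prop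
  have h2 : Continuous (gamma2 μ₁ μ₂ σ₁ σ₂ ρ β) := by unfold gamma2; fun_prop
  simp_rw [integral_const_mul]
  rw [integral_Iio_biGauss _ _ _ _ hσ₁ hσ₂ hρ, integral_Ioi_biGauss _ _ _ _ hσ₁ hσ₂ hρ,
    neg_one_mul, neg_add_eq_sub, ← integral_sub (integrable_gaussTail h2).integrableOn
      (integrable_gaussTail h1).integrableOn]
  congr! 2 with t
  simp only [gaussTail]
  ring
end

section
/- Closed form of the tail integral S. For all real a, b and p, ∫_{p}^{∞} x·e^{−x²}·erf(ax+b) dx = (1/2)·erf(ap+b)·e^{−p²} + (a/(2√(a²+1)))·e^{−b²/(a²+1)}·[1 − erf((p(a²+1) + ab)/√(a²+1))]. -/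
open MeasureTheory

theorem integrable_mul_exp_neg_sq : Integrable fun s : ℝ => s * Real.exp (-s ^ 2) := by
  simpa using integrable_mul_exp_neg_mul_sq (one_pos : (0 : ℝ) < 1)

theorem hasDerivAt_erf (x : ℝ) :
    HasDerivAt erf (2 / Real.sqrt Real.pi * Real.exp (-x ^ 2)) x := by
  have hc : Continuous fun s : ℝ => Real.exp (-s ^ 2) := by fun_prop
  exact (hc.integral_hasStrictDerivAt 0 x).hasDerivAt.const_mul _

theorem tendsto_erf_atTop : Filter.Tendsto erf Filter.atTop (nhds 1) := by
  have hI := (intervalIntegral_tendsto_integral_Ioi 0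
    integrable_exp_neg_sq.integrableOn Filter.tendsto_id).const_mul (2 / Real.sqrt Real.pi)
  have hG : ∫ s in Set.Ioi (0 : ℝ), Real.exp (-s ^ 2) = Real.sqrt Real.pi / 2 := by
    simpa using integral_gaussian_Ioi 1
  have hpi : Real.sqrt Real.pi ≠ 0 := (Real.sqrt_pos.2 Real.pi_pos).ne'
  rw [hG, show 2 / Real.sqrt Real.pi * (Real.sqrt Real.pi / 2) = 1 by field_simp] at hI
  exact hI

theorem abs_erf_le_two (x : ℝ) : |erf x| ≤ 2 := by
  have hG : ∫ s : ℝ, Real.exp (-s ^ 2) = Real.sqrt Real.pi := by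
    simpa using integral_gaussian 1
  have hpi : 0 < Real.sqrt Real.pi := Real.sqrt_pos.2 Real.pi_pos
  have hle : |∫ s in (0 : ℝ)..x, Real.exp (-s ^ 2)| ≤ Real.sqrt Real.pi := by
    rw [← hG]
    refine (intervalIntegral.norm_integral_le_integral_norm_uIoc (E := ℝ)).trans ?_
    simp only [Real.norm_eq_abs, Real.abs_exp]
    exact setIntegral_le_integral integrable_exp_neg_sq
      (Filter.Eventually.of_forall fun s => (Real.exp_pos _).le)
  rw [erf, abs_mul, abs_of_pos (by positivity)]
  calc 2 / Real.sqrt Real.pi * |∫ s in (0 : ℝ)..x, Real.exp (-s ^ 2)|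
      ≤ 2 / Real.sqrt Real.pi * Real.sqrt Real.pi := by gcongr
    _ = 2 := by field_simp

theorem integrable_mul_exp_neg_sq_mul_erf (a b : ℝ) :
    Integrable fun x : ℝ => x * Real.exp (-x ^ 2) * erf (a * x + b) :=
  integrable_mul_exp_neg_sq.mul_bdd
    (continuous_erf.comp (by fun_prop)).aestronglyMeasurable
    (Filter.Eventually.of_forall fun x => abs_erf_le_two (a * x + b))

/-- An antiderivative of `x * exp (-x ^ 2) * erf (a * x + b)`, by parts and completing the
square. -/
theorem hasDerivAt_antideriv_mul_exp_neg_sq_mul_erf (a b x : ℝ) :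
    HasDerivAt (fun x : ℝ => -(1 / 2 * erf (a * x + b) * Real.exp (-x ^ 2)) +
        a / (2 * Real.sqrt (a ^ 2 + 1)) * Real.exp (-b ^ 2 / (a ^ 2 + 1)) *
          erf ((x * (a ^ 2 + 1) + a * b) / Real.sqrt (a ^ 2 + 1)))
      (x * Real.exp (-x ^ 2) * erf (a * x + b)) x := by
  have hc : 0 < a ^ 2 + 1 := by positivity
  set r := Real.sqrt (a ^ 2 + 1) with hr
  have hr0 : r ≠ 0 := (Real.sqrt_pos.2 hc).ne'
  have hr2 : a ^ 2 + 1 = r ^ 2 := (Real.sq_sqrt hc.le).symm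
  have hlin : HasDerivAt (fun x : ℝ => a * x + b) a x := by
    simpa using ((hasDerivAt_id x).const_mul a).add_const b
  have hlin' : HasDerivAt (fun x : ℝ => (x * (a ^ 2 + 1) + a * b) / r) ((a ^ 2 + 1) / r) x := by
    simpa using (((hasDerivAt_id x).mul_const (a ^ 2 + 1)).add_const (a * b)).div_const r
  have hexp : HasDerivAt (fun x : ℝ => Real.exp (-x ^ 2)) (Real.exp (-x ^ 2) * (-(2 * x))) x := by
    simpa using (hasDerivAt_pow 2 x).neg.exp
  have h₁ := (hasDerivAt_erf (a * x + b)).comp x hlin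
  have h₂ := (hasDerivAt_erf ((x * (a ^ 2 + 1) + a * b) / r)).comp x hlin'
  have key : Real.exp (-b ^ 2 / (a ^ 2 + 1)) *
      Real.exp (-((x * (a ^ 2 + 1) + a * b) / r) ^ 2) =
      Real.exp (-(a * x + b) ^ 2) * Real.exp (-x ^ 2) := by
    rw [← Real.exp_add, ← Real.exp_add, div_pow, ← hr2]
    congr 1
    field_simp
    ring
  refine (((h₁.const_mul (1 / 2)).mul hexp).neg.add
    (h₂.const_mul (a / (2 * r) * Real.exp (-b ^ 2 / (a ^ 2 + 1))))).congr_deriv ?_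
  have hK : a / (2 * r) * ((a ^ 2 + 1) / r) = a / 2 := by
    rw [hr2]; field_simp
  simp only [Function.comp_apply]
  linear_combination (2 / Real.sqrt Real.pi) * (a / 2) * key +
    (2 / Real.sqrt Real.pi) * (Real.exp (-b ^ 2 / (a ^ 2 + 1)) *
      Real.exp (-((x * (a ^ 2 + 1) + a * b) / r) ^ 2)) * hK

theorem tendsto_antideriv_mul_exp_neg_sq_mul_erf (a b : ℝ) :
    Filter.Tendsto (fun x : ℝ => -(1 / 2 * erf (a * x + b) * Real.exp (-x ^ 2)) +
        a / (2 * Real.sqrt (a ^ 2 + 1)) * Real.exp (-b ^ 2 / (a ^ 2 + 1)) *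
          erf ((x * (a ^ 2 + 1) + a * b) / Real.sqrt (a ^ 2 + 1)))
      Filter.atTop
      (nhds (a / (2 * Real.sqrt (a ^ 2 + 1)) * Real.exp (-b ^ 2 / (a ^ 2 + 1)))) := by
  have hc : 0 < a ^ 2 + 1 := by positivity
  have hexp : Filter.Tendsto (fun x : ℝ => Real.exp (-x ^ 2)) Filter.atTop (nhds 0) :=
    Real.tendsto_exp_neg_atTop_nhds_zero.comp (Filter.tendsto_pow_atTop two_ne_zero)
  have h₁ : Filter.Tendsto (fun x : ℝ => 1 / 2 * erf (a * x + b) * Real.exp (-x ^ 2))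
      Filter.atTop (nhds 0) := by
    refine squeeze_zero_norm (fun x => ?_) hexp
    rw [Real.norm_eq_abs, abs_mul, abs_mul, Real.abs_exp, abs_of_pos (by norm_num : (0 : ℝ) < 1 / 2)]
    nlinarith [abs_erf_le_two (a * x + b), Real.exp_pos (-x ^ 2)]
  have hlin : Filter.Tendsto
      (fun x : ℝ => (x * (a ^ 2 + 1) + a * b) / Real.sqrt (a ^ 2 + 1))
      Filter.atTop Filter.atTop :=
    (Filter.tendsto_atTop_add_const_right _ _
      (Filter.tendsto_id.atTop_mul_const hc)).atTop_div_const (Real.sqrt_pos.2 hc)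
  simpa using h₁.neg.add ((tendsto_erf_atTop.comp hlin).const_mul
    (a / (2 * Real.sqrt (a ^ 2 + 1)) * Real.exp (-b ^ 2 / (a ^ 2 + 1))))

/-- **Closed form of the tail integral `S`.** -/
theorem tail_integral_S (a b p : ℝ) :
    (∫ x in Set.Ioi p, x * Real.exp (-x ^ 2) * erf (a * x + b)) =
      1 / 2 * erf (a * p + b) * Real.exp (-p ^ 2) +
        a / (2 * Real.sqrt (a ^ 2 + 1)) * Real.exp (-b ^ 2 / (a ^ 2 + 1)) *
          (1 - erf ((p * (a ^ 2 + 1) + a * b) / Real.sqrt (a ^ 2 + 1))) := by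
  rw [integral_Ioi_of_hasDerivAt_of_tendsto'
    (fun x _ => hasDerivAt_antideriv_mul_exp_neg_sq_mul_erf a b x)
    (integrable_mul_exp_neg_sq_mul_erf a b).integrableOn
    (tendsto_antideriv_mul_exp_neg_sq_mul_erf a b)]
  ring
end

section
/- Admissible correlation range for series convergence. Let σ₁, σ₂ be real with 0 < σ₂ < σ₁, let ρ ∈ (−1, 1), and set K₁ = (σ₂ + ρσ₁)/(σ₁√(1−ρ²)) and K₃ = (σ₂ − ρσ₁)/(σ₁√(1−ρ²)). Then |K₁| < 1 and |K₃| < 1 hold simultaneously if and only if −(1/2)·(√(2 − (σ₂/σ₁)²) − σ₂/σ₁) < ρ < (1/2)·(√(2 − (σ₂/σ₁)²) − σ₂/σ₁). -/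
theorem abs_div_mul_sqrt_lt_one_iff {a b t : ℝ} (ha : 0 < a) (ht : t ^ 2 < 1) :
    |(b + t * a) / (a * Real.sqrt (1 - t ^ 2))| < 1 ↔
      -Real.sqrt (2 - (b / a) ^ 2) < 2 * t + b / a ∧
        2 * t + b / a < Real.sqrt (2 - (b / a) ^ 2) := by
  have hs : 0 < Real.sqrt (1 - t ^ 2) := Real.sqrt_pos.2 (by linarith)
  have h : (b + t * a) / (a * Real.sqrt (1 - t ^ 2)) =
      (b / a + t) / Real.sqrt (1 - t ^ 2) := by
    field_simp
  rw [h, abs_div, abs_of_pos hs, div_lt_one hs, abs_lt, ← Real.sq_lt, ← Real.sq_lt]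
  constructor <;> intro h <;> linarith

/-- **Admissible correlation range for series convergence.** With `0 < σ₂ < σ₁`,
`ρ ∈ (−1,1)`, `K₁ = (σ₂ + ρσ₁)/(σ₁√(1−ρ²))` and `K₃ = (σ₂ − ρσ₁)/(σ₁√(1−ρ²))`,
one has `|K₁| < 1 ∧ |K₃| < 1` iff
`−(1/2)(√(2 − (σ₂/σ₁)²) − σ₂/σ₁) < ρ < (1/2)(√(2 − (σ₂/σ₁)²) − σ₂/σ₁)`. -/
theorem admissible_correlation_range
    (σ₁ σ₂ ρ : ℝ) (hσ₂ : 0 < σ₂) (hσ : σ₂ < σ₁) (hρ : ρ ∈ Set.Ioo (-1 : ℝ) 1)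
    (K₁ K₃ : ℝ)
    (hK₁ : K₁ = (σ₂ + ρ * σ₁) / (σ₁ * Real.sqrt (1 - ρ ^ 2)))
    (hK₃ : K₃ = (σ₂ - ρ * σ₁) / (σ₁ * Real.sqrt (1 - ρ ^ 2))) :
    (|K₁| < 1 ∧ |K₃| < 1) ↔
      (-(1 / 2) * (Real.sqrt (2 - (σ₂ / σ₁) ^ 2) - σ₂ / σ₁) < ρ ∧
        ρ < 1 / 2 * (Real.sqrt (2 - (σ₂ / σ₁) ^ 2) - σ₂ / σ₁)) := by
  obtain ⟨h₁, h₂⟩ := hρ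
  have hσ₁ : 0 < σ₁ := hσ₂.trans hσ
  have hr : 0 < σ₂ / σ₁ := div_pos hσ₂ hσ₁
  have hρ : ρ ^ 2 < 1 := by nlinarith
  have h₁' := abs_div_mul_sqrt_lt_one_iff (b := σ₂) hσ₁ hρ
  have h₃' := abs_div_mul_sqrt_lt_one_iff (b := σ₂) (t := -ρ) hσ₁ (by rwa [neg_sq])
  rw [neg_sq, neg_mul, ← sub_eq_add_neg] at h₃'
  rw [hK₁, hK₃, h₁', h₃']
  constructor
  · rintro ⟨⟨-, h⟩, ⟨-, h'⟩⟩
    constructor <;> linarith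
  · rintro ⟨h, h'⟩
    refine ⟨⟨?_, ?_⟩, ?_, ?_⟩ <;> linarith
end
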